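/- Let H ⊆ ℕ^d be a normal simplicial fully embedded affine semigroup. For any b ∈ H there exists a positive integer k such that for all c_1, …, c_k ∈ ω_H one has c_1 + ⋯ + c_k ∈ b + H. -/

import Mathlib

open scoped BigOperators

set_option maxHeartbeats 1000000
set_option synthInstance.maxHeartbeats 400000

noncomputable section

namespace AffineSG

variable {d : ℕ}

/-- Real vector attached to a lattice point of `ℕ^d`. -/
def toR (h : Fin d → ℕ) : Fin d → ℝ := fun i => (h i : ℝ)

/-- Integer vector attached to a lattice point of `ℕ^d`. -/
def toZ (h : Fin d → ℕ) : Fin d → ℤ := fun i => (h i : ℤ)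

/-- The rational polyhedral cone generated by the affine semigroup `H`:
all finite nonnegative real combinations of elements of `H`. -/
def coneOf (H : AddSubmonoid (Fin d → ℕ)) : Set (Fin d → ℝ) :=
  {z | ∃ (n : ℕ) (c : Fin n → ℝ) (v : Fin n → (Fin d → ℕ)),
    (∀ k, 0 ≤ c k) ∧ (∀ k, v k ∈ H) ∧ z = ∑ k, c k • toR (v k)}

/-- `v` spans an extremal ray of the (pointed) cone `C`. -/
def IsExtremalRay (C : Set (Fin d → ℝ)) (v : Fin d → ℝ) : Prop :=
  v ∈ C ∧ v ≠ 0 ∧ ∀ x ∈ C, ∀ y ∈ C, x + y = v → ∃ t : ℝ, 0 ≤ t ∧ x = t • v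

/-- `ω_H`: the lattice points in the relative interior of the cone of `H`
(for a fully embedded semigroup the cone is full-dimensional, so the relative
interior is the topological interior; all such lattice points lie in `ℕ^d`). -/
def omegaSet (H : AddSubmonoid (Fin d → ℕ)) : Set (Fin d → ℕ) :=
  {h | toR h ∈ interior (coneOf H)}

/-- The Hilbert basis of `H`: its irreducible nonzero elements, i.e. the unique
minimal generating set of the (pointed) affine semigroup `H ⊆ ℕ^d`. -/
def hilbertBasis (H : AddSubmonoid (Fin d → ℕ)) : Set (Fin d → ℕ) :=
  {h | h ∈ H ∧ h ≠ 0 ∧ ∀ u v : Fin d → ℕ, u ∈ H → v ∈ H → u ≠ 0 → v ≠ 0 → h ≠ u + v}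

/-- `H` is a normal semigroup. -/
def Normal (H : AddSubmonoid (Fin d → ℕ)) : Prop :=
  ∀ (h : Fin d → ℕ) (n : ℕ), 0 < n → n • h ∈ H → h ∈ H

/-- `H` is fully embedded in `ℕ^d`: the group generated by `H` is all of `ℤ^d`. -/
def FullyEmbedded (H : AddSubmonoid (Fin d → ℕ)) : Prop :=
  AddSubgroup.closure (toZ '' (H : Set (Fin d → ℕ))) = (⊤ : AddSubgroup (Fin d → ℤ))

/-- `H` is simplicial with extremal rays `a 1, …, a d`: each `a i` is a primitive
lattice vector of `H` spanning an extremal ray of the cone, the `a i` are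
linearly independent over `ℝ` (they form an `ℝ`-basis of `ℝ^d`), and every
extremal ray of the cone is spanned by some `a i`. -/
def SimplicialWithRays (H : AddSubmonoid (Fin d → ℕ)) (a : Fin d → (Fin d → ℕ)) : Prop :=
  (∀ i, a i ∈ H) ∧
  (∀ i, IsExtremalRay (coneOf H) (toR (a i))) ∧
  (∀ i, Finset.univ.gcd (a i) = 1) ∧
  LinearIndependent ℝ (fun i => toR (a i)) ∧
  (∀ v, IsExtremalRay (coneOf H) v → ∃ (i : Fin d) (t : ℝ), 0 ≤ t ∧ v = t • toR (a i))

/-- `H` is slim: for every `c` in the Hilbert basis outside `ω_H`, the sum of the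
coordinates of `c` with respect to the basis `a 1, …, a d` is at least `1`. -/
def Slim (H : AddSubmonoid (Fin d → ℕ)) (a : Fin d → (Fin d → ℕ)) : Prop :=
  ∀ c ∈ hilbertBasis H \ omegaSet H,
    ∀ lam : Fin d → ℝ, toR c = ∑ i, lam i • toR (a i) → 1 ≤ ∑ i, lam i

/-- The minimal generating set `G(ω_H)` of the semigroup ideal `ω_H`. -/
def minGens (H : AddSubmonoid (Fin d → ℕ)) : Set (Fin d → ℕ) :=
  {g | g ∈ omegaSet H ∧ ∀ g' ∈ omegaSet H, ∀ h ∈ H, h ≠ 0 → g ≠ g' + h}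

variable (K : Type*) [Field K]

/-- The monomial `x^h` of `K[x_1,…,x_d]`. -/
def mono (h : Fin d → ℕ) : MvPolynomial (Fin d) K :=
  MvPolynomial.monomial (Finsupp.equivFunOnFinite.symm h) 1

/-- The semigroup ring `R = K[H] ⊆ K[x_1,…,x_d]`, spanned by the monomials `x^h`, `h ∈ H`. -/
def sgRing (H : AddSubmonoid (Fin d → ℕ)) : Subalgebra K (MvPolynomial (Fin d) K) :=
  Algebra.adjoin K {p | ∃ h ∈ H, p = mono K h}

/-- The monomial `x^h` as an element of `K[H]`. -/
def xpow {H : AddSubmonoid (Fin d → ℕ)} {h : Fin d → ℕ} (hh : h ∈ H) : sgRing K H :=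
  ⟨mono K h, Algebra.subset_adjoin ⟨h, hh, rfl⟩⟩

/-- The graded maximal ideal `𝔪` of `K[H]`, generated by all `x^h`, `0 ≠ h ∈ H`. -/
def maxIdeal (H : AddSubmonoid (Fin d → ℕ)) : Ideal (sgRing K H) :=
  Ideal.span {p | ∃ h, (h ∈ H ∧ h ≠ 0) ∧ (p : MvPolynomial (Fin d) K) = mono K h}

/-- The canonical module `ω_R` of `R = K[H]`, realized as the ideal of `R`
generated by the monomials `x^h`, `h ∈ ω_H`. -/
def canIdeal (H : AddSubmonoid (Fin d → ℕ)) : Ideal (sgRing K H) :=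
  Ideal.span {p | ∃ h ∈ omegaSet H, (p : MvPolynomial (Fin d) K) = mono K h}

/-- The ideal `J = (x^{a_i} - x^{a_j} : 1 ≤ i,j ≤ d) R`. -/
def Jideal (H : AddSubmonoid (Fin d → ℕ)) (a : Fin d → (Fin d → ℕ)) : Ideal (sgRing K H) :=
  Ideal.span {p | ∃ i j : Fin d, (p : MvPolynomial (Fin d) K) = mono K (a i) - mono K (a j)}

/-- The principal ideal `x^b R` of `R = K[H]`. -/
def prIdeal (H : AddSubmonoid (Fin d → ℕ)) (b : Fin d → ℕ) : Ideal (sgRing K H) :=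
  Ideal.span {p | (p : MvPolynomial (Fin d) K) = mono K b}

/-- `b` is an Ulrich element of `H`: `𝔪 ω_R ⊆ x^b R + J ω_R`. -/
def IsUlrich (H : AddSubmonoid (Fin d → ℕ)) (a : Fin d → (Fin d → ℕ)) (b : Fin d → ℕ) : Prop :=
  maxIdeal K H * canIdeal K H ≤ prIdeal K H b ⊔ Jideal K H a * canIdeal K H

/-- The principal ideal `(x^{a_1} - x^{a_2}) R` (for `d = 2`). -/
def diffIdeal (H : AddSubmonoid (Fin 2 → ℕ)) (a1 a2 : Fin 2 → ℕ) : Ideal (sgRing K H) :=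
  Ideal.span {p | (p : MvPolynomial (Fin 2) K) = mono K a1 - mono K a2}

/-- For `d = 2`: `b` is an Ulrich element of `H`, i.e.
`𝔪 ω_R ⊆ x^b R + (x^{a_1} - x^{a_2}) ω_R`. -/
def IsUlrich2 (H : AddSubmonoid (Fin 2 → ℕ)) (a1 a2 b : Fin 2 → ℕ) : Prop :=
  maxIdeal K H * canIdeal K H ≤ prIdeal K H b ⊔ diffIdeal K H a1 a2 * canIdeal K H

/-- For `d = 2`: the lattice points `H_i = C_i ∩ ℤ²` of the cone generated by `b` and `a`. -/
def coneTwo (b a : Fin 2 → ℕ) : Set (Fin 2 → ℕ) :=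
  {p | ∃ lam mu : ℝ, 0 ≤ lam ∧ 0 ≤ mu ∧ toR p = lam • toR b + mu • toR a}

/-- For `d = 2`: `H_i^* = ℤ² ∩ relint P_{H_i}`, the lattice points in the relative
interior of the fundamental parallelogram spanned by `b` and `a`. -/
def Hstar (b a : Fin 2 → ℕ) : Set (Fin 2 → ℕ) :=
  {p | ∃ lam mu : ℝ, 0 < lam ∧ lam < 1 ∧ 0 < mu ∧ mu < 1 ∧
    toR p = lam • toR b + mu • toR a}

/-- `b` is the bottom element of `H`: the (unique) componentwise-minimal element of `ω_H`. -/
def IsBottom (H : AddSubmonoid (Fin 2 → ℕ)) (b : Fin 2 → ℕ) : Prop :=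
  b ∈ omegaSet H ∧ ∀ c ∈ omegaSet H, b ≤ c

/-- The condition AG1 (for `a = a_1`), resp. AG2 (for `a = a_2`):
the sum of two points of `H_i^*` is never in `H_i^*`. -/
def AGcond (b a : Fin 2 → ℕ) : Prop :=
  ∀ p ∈ Hstar b a, ∀ q ∈ Hstar b a, p + q ∉ Hstar b a

end AffineSG

end

namespace AffineSG

/-- A finite set of nonnegative vectors contains a subset which generates the same cone and
each member of which spans an extremal ray of that cone. -/
theorem exists_subset_extremal {d : ℕ} (C : Set (Fin d → ℝ)) (S : Finset (Fin d → ℝ))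
    (hSC : ∀ s ∈ S, s ∈ C) (hS0 : ∀ s ∈ S, 0 ≤ s)
    (hC : C ⊆ Submodule.span NNReal (S : Set (Fin d → ℝ))) :
    ∃ T ⊆ S, (∀ t ∈ T, IsExtremalRay C t) ∧
      C ⊆ Submodule.span NNReal (T : Set (Fin d → ℝ)) := by
  classical
  obtain ⟨T, ⟨hTS, hCT⟩, hmin⟩ := WellFounded.has_min
    (wellFounded_lt : WellFounded ((· < ·) : Finset (Fin d → ℝ) → Finset (Fin d → ℝ) → Prop))
    {T | T ⊆ S ∧ C ⊆ Submodule.span NNReal (T : Set (Fin d → ℝ))} ⟨S, Finset.Subset.refl _, hC⟩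
  refine ⟨T, hTS, fun t ht => ?_, hCT⟩
  have hins : (T : Set (Fin d → ℝ)) = insert t ((T.erase t : Finset _) : Set (Fin d → ℝ)) := by
    rw [← Finset.coe_insert, Finset.insert_erase ht]
  have hnot : t ∉ Submodule.span NNReal ((T.erase t : Finset _) : Set (Fin d → ℝ)) := by
    intro hmem
    refine hmin (T.erase t) ⟨(Finset.erase_subset _ _).trans hTS, ?_⟩ (Finset.erase_ssubset ht)
    rw [hins, Submodule.span_insert_eq_span hmem] at hCT
    exact hCT
  have hnonneg : ∀ z ∈ Submodule.span NNReal ((T.erase t : Finset _) : Set (Fin d → ℝ)),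
      0 ≤ z := by
    intro z hz
    induction hz using Submodule.span_induction with
    | mem x hx => exact hS0 x (hTS (Finset.mem_of_mem_erase hx))
    | zero => exact le_rfl
    | add x y _ _ hx hy => exact add_nonneg hx hy
    | smul c x _ hx => exact smul_nonneg c.2 hx
  refine ⟨hSC t (hTS ht), fun h0 => hnot (h0 ▸ Submodule.zero_mem _), fun x hx y hy hxy => ?_⟩
  have hx' := hCT hx
  have hy' := hCT hy
  rw [hins, SetLike.mem_coe, Submodule.mem_span_insert] at hx' hy'
  obtain ⟨α, z, hz, rfl⟩ := hx'
  obtain ⟨β, w, hw, rfl⟩ := hy'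
  have ht0 := hS0 t (hTS ht)
  have hcoord : ∀ i, (α : ℝ) * t i + z i + (β * t i + w i) = t i := fun i => by
    simpa [NNReal.smul_def] using congrFun hxy i
  rcases lt_or_ge ((α : ℝ) + β) 1 with hlt | hge
  · refine absurd ?_ hnot
    have hpos : 0 < 1 - ((α : ℝ) + β) := by linarith
    obtain ⟨r, hr⟩ : ∃ r : NNReal, (r : ℝ) = (1 - ((α : ℝ) + β))⁻¹ :=
      ⟨⟨_, (inv_pos.2 hpos).le⟩, rfl⟩
    have hteq : r • (z + w) = t := by
      ext i
      simp only [NNReal.smul_def, hr, Pi.smul_apply, Pi.add_apply, smul_eq_mul]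
      rw [inv_mul_eq_iff_eq_mul₀ hpos.ne']
      linarith [hcoord i]
    have hmem := Submodule.smul_mem _ r (Submodule.add_mem _ hz hw)
    rwa [hteq] at hmem
  · refine ⟨α, α.2, ?_⟩
    ext i
    have h1 := hnonneg z hz i
    have h2 := hnonneg w hw i
    have h3 := mul_nonneg (sub_nonneg.2 hge) (ht0 i)
    simp only [Pi.zero_apply] at h1 h2
    simp only [NNReal.smul_def, Pi.add_apply, Pi.smul_apply, smul_eq_mul]
    nlinarith [hcoord i]

theorem toR_mem_coneOf {d : ℕ} {H : AddSubmonoid (Fin d → ℕ)} {h : Fin d → ℕ} (hh : h ∈ H) :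
    toR h ∈ coneOf H :=
  ⟨1, fun _ => 1, fun _ => h, fun _ => zero_le_one, fun _ => hh, by simp⟩

/-- The cone of a simplicial affine semigroup is generated by its extremal rays. -/
theorem SimplicialWithRays.exists_nonneg_coeff {d : ℕ} {H : AddSubmonoid (Fin d → ℕ)}
    {a : Fin d → (Fin d → ℕ)} (hS : SimplicialWithRays H a) (hFG : H.FG)
    {z : Fin d → ℝ} (hz : z ∈ coneOf H) :
    ∃ c : Fin d → NNReal, ∑ i, c i • toR (a i) = z := by
  classical
  obtain ⟨G, hG⟩ := hFG
  have hGH : ∀ g ∈ G, g ∈ H := fun g hg => hG ▸ AddSubmonoid.subset_closure hg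
  have hgen : ∀ h ∈ H, toR h ∈ Submodule.span NNReal ((G.image toR : Finset _) :
      Set (Fin d → ℝ)) := by
    intro h hh
    rw [← hG] at hh
    induction hh using AddSubmonoid.closure_induction with
    | mem x hx => exact Submodule.subset_span (Finset.mem_coe.2 (Finset.mem_image_of_mem _ hx))
    | zero =>
      convert Submodule.zero_mem _
      ext i
      simp [toR]
    | add x y _ _ hx hy =>
      convert Submodule.add_mem _ hx hy
      ext i
      simp [toR]
  obtain ⟨T, -, hText, hT⟩ := exists_subset_extremal (coneOf H) (G.image toR)
    (by
      simp only [Finset.mem_image]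
      rintro _ ⟨g, hg, rfl⟩
      exact toR_mem_coneOf (hGH g hg))
    (by
      simp only [Finset.mem_image]
      rintro _ ⟨g, -, rfl⟩ i
      exact Nat.cast_nonneg _)
    (by
      rintro _ ⟨n, c, v, hc, hv, rfl⟩
      exact Submodule.sum_mem _ fun k _ =>
        Submodule.smul_mem _ (⟨c k, hc k⟩ : NNReal) (hgen _ (hv k)))
  rw [← Submodule.mem_span_range_iff_exists_fun]
  refine Submodule.span_le.2 (fun t ht => ?_) (hT hz)
  obtain ⟨i, r, hr, rfl⟩ := hS.2.2.2.2 t (hText t ht)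
  exact Submodule.smul_mem _ (⟨r, hr⟩ : NNReal) (Submodule.subset_span ⟨i, rfl⟩)

/-- Linearly independent lattice vectors span a sublattice of positive finite index: some
positive multiple of each lattice point has integral coordinates, depending additively on it. -/
theorem exists_integral_coordinates {d : ℕ} (a : Fin d → (Fin d → ℕ))
    (ha : LinearIndependent ℝ (fun i => toR (a i))) :
    ∃ (N : ℕ) (m : (Fin d → ℤ) →+ (Fin d → ℤ)), 0 < N ∧
      ∀ z : Fin d → ℤ, (N : ℤ) • z = ∑ i, m z i • toZ (a i) := by
  let A : Matrix (Fin d) (Fin d) ℤ := Matrix.of fun i => toZ (a i)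
  have hdet : A.det ≠ 0 := by
    intro h0
    have hR : (A.map (Int.castRingHom ℝ)).det = 0 := by
      rw [← RingHom.mapMatrix_apply, ← RingHom.map_det, h0, map_zero]
    have hrow : (A.map (Int.castRingHom ℝ)).row = fun i => toR (a i) := by
      ext i j
      simp [A, toR, toZ, Matrix.row]
    rw [← hrow, Matrix.linearIndependent_rows_iff_isUnit, Matrix.isUnit_iff_isUnit_det, hR] at ha
    exact not_isUnit_zero ha
  refine ⟨(A.det ^ 2).toNat, (A.det • A.adjugate).vecMulLinear.toAddMonoidHom, ?_, fun z => ?_⟩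
  · have : 0 < A.det ^ 2 := by positivity
    omega
  · rw [Int.toNat_of_nonneg (sq_nonneg _)]
    have h : Matrix.vecMul (Matrix.vecMul z (A.det • A.adjugate)) A = (A.det ^ 2) • z := by
      rw [Matrix.vecMul_vecMul, Matrix.smul_mul, Matrix.adjugate_mul, smul_smul, ← sq,
        Matrix.vecMul_smul, Matrix.vecMul_one]
    rw [← h, Matrix.vecMul_eq_sum]
    rfl

/-- Lattice points in the interior of a simplicial cone have positive coordinates. -/
theorem SimplicialWithRays.coeff_pos {d : ℕ} {H : AddSubmonoid (Fin d → ℕ)}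
    {a : Fin d → (Fin d → ℕ)} (hS : SimplicialWithRays H a) (hFG : H.FG)
    {c : Fin d → ℕ} (hc : c ∈ omegaSet H) {N : ℕ} (hN : 0 < N) {m : Fin d → ℤ}
    (hm : (N : ℤ) • toZ c = ∑ i, m i • toZ (a i)) (i : Fin d) : 0 < m i := by
  classical
  have hcont : Filter.Tendsto (fun ε : ℝ => toR c - ε • toR (a i)) (nhdsWithin 0 (Set.Ioi 0))
      (nhds (toR c)) := by
    have : Continuous fun ε : ℝ => toR c - ε • toR (a i) := by fun_prop
    simpa using (this.tendsto 0).mono_left nhdsWithin_le_nhds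
  obtain ⟨ε, hεC, hε⟩ := ((hcont.eventually (mem_interior_iff_mem_nhds.1 hc)).and
    self_mem_nhdsWithin).exists
  obtain ⟨μ, hμ⟩ := hS.exists_nonneg_coeff hFG hεC
  have hmR : (N : ℝ) • toR c = ∑ j, (m j : ℝ) • toR (a j) := by
    ext l
    have := congrArg (Int.cast : ℤ → ℝ) (congrFun hm l)
    simpa [toR, toZ, Finset.sum_apply] using this
  have hsum : ∑ j, ((m j : ℝ) - N * (μ j + if j = i then ε else 0)) • toR (a j) = 0 := by
    have hεi : ∑ j, (if j = i then ε else 0) • toR (a j) = ε • toR (a i) := by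
      simp [ite_smul]
    have hμ' : ∑ j, (μ j : ℝ) • toR (a j) = toR c - ε • toR (a i) := hμ
    simp only [sub_smul, mul_smul, add_smul, Finset.sum_sub_distrib, Finset.sum_add_distrib,
      ← Finset.smul_sum, hεi, hμ', ← hmR]
    simp
  have hi := Fintype.linearIndependent_iff.1 hS.2.2.2.1 _ hsum i
  simp only [if_true] at hi
  have hpos : (0 : ℝ) < N * (μ i + ε) :=
    mul_pos (Nat.cast_pos.2 hN) (add_pos_of_nonneg_of_pos (μ i).2 hε)
  have : (0 : ℝ) < m i := by linarith
  exact_mod_cast this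

/-- for any `b ∈ H` there is a positive integer `k` such that
any sum of `k` elements of `ω_H` lies in `b + H`. -/
theorem statement_1 (d : ℕ)
    (H : AddSubmonoid (Fin d → ℕ)) (hFG : H.FG)
    (hFE : FullyEmbedded H) (hNor : Normal H)
    (a : Fin d → (Fin d → ℕ)) (hS : SimplicialWithRays H a)
    (b : Fin d → ℕ) (hb : b ∈ H) :
    ∃ k : ℕ, 0 < k ∧ ∀ c : Fin k → (Fin d → ℕ),
      (∀ i, c i ∈ omegaSet H) → ∃ h ∈ H, (∑ i, c i) = b + h := by
  obtain ⟨N, m, hN, hm⟩ := exists_integral_coordinates a hS.2.2.2.1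
  refine ⟨1 + ∑ i, (m (toZ b) i).natAbs, by omega, fun c hc => ?_⟩
  set z : Fin d → ℤ := ∑ j, toZ (c j) - toZ b with hz
  have hmz : ∀ i, 0 ≤ m z i := by
    intro i
    have h1 : ∀ j, 1 ≤ m (toZ (c j)) i := fun j => hS.coeff_pos hFG (hc j) hN (hm _) i
    have h2 : (m (toZ b) i).natAbs ≤ ∑ i, (m (toZ b) i).natAbs :=
      Finset.single_le_sum (f := fun i => (m (toZ b) i).natAbs) (fun _ _ => Nat.zero_le _)
        (Finset.mem_univ i)
    have h3 := Finset.card_nsmul_le_sum Finset.univ (fun j => m (toZ (c j)) i) 1 fun j _ => h1 j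
    rw [Finset.card_univ, Fintype.card_fin, nsmul_one] at h3
    simp only [hz, map_sub, map_sum, Pi.sub_apply, Finset.sum_apply]
    omega
  have hNz := hm z
  have hz0 : ∀ l, 0 ≤ z l := by
    intro l
    have hl : (N : ℤ) * z l = ∑ i, m z i * (a i l : ℤ) := by
      simpa [toZ, Finset.sum_apply] using congrFun hNz l
    refine nonneg_of_mul_nonneg_right (hl ▸ Finset.sum_nonneg fun i _ =>
      mul_nonneg (hmz i) (Int.natCast_nonneg _)) (Int.natCast_pos.2 hN)
  refine ⟨fun l => (z l).toNat, hNor _ N hN ?_, ?_⟩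
  · have : N • (fun l => (z l).toNat) = ∑ i, (m z i).toNat • a i := by
      ext l
      have hl := congrFun hNz l
      zify
      simp only [Pi.smul_apply, Finset.sum_apply, smul_eq_mul] at hl ⊢
      push_cast
      simpa [hz0, hmz, toZ, max_eq_left] using hl
    rw [this]
    exact H.sum_mem fun i _ => H.nsmul_mem (hS.1 i) _
  · ext l
    have hl := hz0 l
    have hzl : z l = ((∑ j, c j l : ℕ) : ℤ) - b l := by
      simp [hz, toZ, Finset.sum_apply]
    simp only [Pi.add_apply, Finset.sum_apply]
    omega

end AffineSG
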